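/- Fix N ≥ 2 and 0 ≤ M ≤ C(N,2). The complement map A ↦ A' = 𝟙 − A − I is an involutive bijection from the set G(N, M) of adjacency matrices of simple graphs on N labeled nodes with exactly M edges onto the set G(N, C(N,2) − M), and it preserves E. Consequently Σ_{A ∈ G(N,M)} E(A) = Σ_{B ∈ G(N, C(N,2)−M)} E(B); i.e., the ensemble averages of E (and of 𝒮) over G(N, M) and over G(N, C(N,2) − M) are equal. -/

import Mathlib

open Matrix BigOperators
open scoped Classical

/-- Entrywise ℓ¹ norm of a square matrix: sum of absolute values of all entries. -/
noncomputable def l1norm {ι : Type*} [Fintype ι] (M : Matrix ι ι ℝ) : ℝ :=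
  ∑ i, ∑ j, |M i j|

/-- The permutation matrix of a permutation σ: `P i j = 1` iff `σ j = i`. -/
noncomputable def permMat {ι : Type*} [Fintype ι] [DecidableEq ι]
    (σ : Equiv.Perm ι) : Matrix ι ι ℝ :=
  Matrix.of fun i j => if σ j = i then 1 else 0

/-- A matrix is a permutation matrix if it encodes some permutation. -/
def IsPermMatrix {ι : Type*} [Fintype ι] [DecidableEq ι] (P : Matrix ι ι ℝ) : Prop :=
  ∃ σ : Equiv.Perm ι, P = permMat σ

/-- 𝓔(A, P) = (1/4)·‖A − P A Pᵀ‖₁. -/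
noncomputable def Ecal {ι : Type*} [Fintype ι] (A P : Matrix ι ι ℝ) : ℝ :=
  (1 / 4) * l1norm (A - P * A * Pᵀ)

/-- E(A): minimum of 𝓔(A, P) over permutation matrices P with trace 0. -/
noncomputable def Easym {ι : Type*} [Fintype ι] [DecidableEq ι]
    (A : Matrix ι ι ℝ) : ℝ :=
  sInf {x : ℝ | ∃ P : Matrix ι ι ℝ, IsPermMatrix P ∧ Matrix.trace P = 0 ∧ x = Ecal A P}

/-- The microcanonical Erdős–Rényi ensemble G(N, M): adjacency matrices of simple
graphs on N labeled nodes with exactly M edges. -/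
def GNM (N M : ℕ) : Set (Matrix (Fin N) (Fin N) ℝ) :=
  {A | Aᵀ = A ∧ (∀ i, A i i = 0) ∧ (∀ i j, A i j = 0 ∨ A i j = 1) ∧
    (Finset.univ.filter (fun p : Fin N × Fin N => p.1 < p.2 ∧ A p.1 p.2 = 1)).card = M}

/-- The complement map A ↦ 𝟙 − A − I. -/
noncomputable def graphCompl {N : ℕ} (A : Matrix (Fin N) (Fin N) ℝ) :
    Matrix (Fin N) (Fin N) ℝ :=
  Matrix.of (fun _ _ => (1 : ℝ)) - A - 1

theorem graphCompl_apply {N : ℕ} (A : Matrix (Fin N) (Fin N) ℝ) (i j : Fin N) :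
    graphCompl A i j = 1 - A i j - if i = j then 1 else 0 := by
  simp [graphCompl, Matrix.one_apply]

theorem graphCompl_graphCompl {N : ℕ} (A : Matrix (Fin N) (Fin N) ℝ) :
    graphCompl (graphCompl A) = A := by
  ext i j
  simp only [graphCompl_apply]
  ring

theorem permMat_mul_mul_transpose_apply {ι : Type*} [Fintype ι] [DecidableEq ι]
    (σ : Equiv.Perm ι) (A : Matrix ι ι ℝ) (i j : ι) :
    (permMat σ * A * (permMat σ)ᵀ) i j = A (σ.symm i) (σ.symm j) := by
  simp [Matrix.mul_apply, permMat, ← Equiv.eq_symm_apply]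

theorem Ecal_graphCompl_permMat {N : ℕ} (A : Matrix (Fin N) (Fin N) ℝ)
    (σ : Equiv.Perm (Fin N)) : Ecal (graphCompl A) (permMat σ) = Ecal A (permMat σ) := by
  unfold Ecal l1norm
  congr 1
  refine Finset.sum_congr rfl fun i _ => Finset.sum_congr rfl fun j _ => ?_
  simp only [Matrix.sub_apply, permMat_mul_mul_transpose_apply, graphCompl_apply,
    EmbeddingLike.apply_eq_iff_eq]
  rw [← abs_neg]
  congr 1
  ring

theorem Easym_graphCompl {N : ℕ} (A : Matrix (Fin N) (Fin N) ℝ) :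
    Easym (graphCompl A) = Easym A := by
  unfold Easym
  congr 1
  ext x
  refine exists_congr fun P => and_congr_right ?_
  rintro ⟨σ, rfl⟩
  rw [Ecal_graphCompl_permMat]

theorem card_filter_fst_lt_snd (N : ℕ) :
    (Finset.univ.filter (fun p : Fin N × Fin N => p.1 < p.2)).card = N.choose 2 := by
  simpa using Finset.card_product_filter_lt (s := (Finset.univ : Finset (Fin N)))

theorem graphCompl_mem_GNM {N M : ℕ} {A : Matrix (Fin N) (Fin N) ℝ} (hA : A ∈ GNM N M) :
    graphCompl A ∈ GNM N (N.choose 2 - M) := by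
  obtain ⟨hsymm, hdiag, hentry, hcard⟩ := hA
  refine ⟨?_, fun i => by simp [graphCompl_apply, hdiag], fun i j => ?_, ?_⟩
  · ext i j
    have hij : A j i = A i j := congrFun (congrFun hsymm i) j
    simp [graphCompl_apply, hij, eq_comm]
  · rw [graphCompl_apply]
    rcases eq_or_ne i j with rfl | hij
    · simp [hdiag]
    · rcases hentry i j with h | h <;> simp [h, hij]
  · have hcompl : ∀ p : Fin N × Fin N,
        (p.1 < p.2 ∧ graphCompl A p.1 p.2 = 1) ↔ (p.1 < p.2 ∧ ¬ A p.1 p.2 = 1) := by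
      refine fun p => and_congr_right fun hp => ?_
      rcases hentry p.1 p.2 with h | h <;> simp [graphCompl_apply, h, hp.ne]
    have hsum := Finset.card_filter_add_card_filter_not
      (s := Finset.univ.filter (fun p : Fin N × Fin N => p.1 < p.2))
      (fun p => A p.1 p.2 = 1)
    simp only [Finset.filter_filter, card_filter_fst_lt_snd, hcard] at hsum
    simp only [hcompl]
    omega

/-- The complement map is an involutive bijection from G(N, M) onto
G(N, C(N,2) − M) preserving E; consequently the total (hence average) E over the
two ensembles coincide. -/
theorem complement_bijection_ensembles {N M : ℕ} (hN : 2 ≤ N) (hM : M ≤ N.choose 2) :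
    (∀ A ∈ GNM N M, graphCompl (graphCompl A) = A) ∧
      Set.BijOn graphCompl (GNM N M) (GNM N (N.choose 2 - M)) ∧
      (∀ A ∈ GNM N M, Easym (graphCompl A) = Easym A) ∧
      ∑ᶠ A ∈ GNM N M, Easym A = ∑ᶠ B ∈ GNM N (N.choose 2 - M), Easym B := by
  have hbij : Set.BijOn graphCompl (GNM N M) (GNM N (N.choose 2 - M)) := by
    refine Set.InvOn.bijOn (f' := graphCompl)
      ⟨fun A _ => graphCompl_graphCompl A, fun A _ => graphCompl_graphCompl A⟩
      (fun A hA => graphCompl_mem_GNM hA) fun B hB => ?_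
    simpa only [Nat.sub_sub_self hM] using graphCompl_mem_GNM hB
  exact ⟨fun A _ => graphCompl_graphCompl A, hbij, fun A _ => Easym_graphCompl A,
    finsum_mem_eq_of_bijOn graphCompl hbij fun A _ => (Easym_graphCompl A).symm⟩
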